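/- arXiv:2407.18127 — 4 statements merged into one kernel-verified Lean document; each statement's English description precedes it below -/
import Mathlib

section
/- Fix m ≥ 0 and x ≥ 1 + log₂(m+2). Then the function h(y) = (1+y)^x − y^x + y^(−x) − m·x·y is monotonically increasing on the interval [1, ∞); that is, for all 1 ≤ k ≤ t one has (1+t)^x − t^x + t^(−x) − m·x·t ≥ (1+k)^x − k^x + k^(−x) − m·x·k. -/
lemma aux_incr (a y : ℝ) (ha : 1 ≤ a) (hy : 1 ≤ y) :
    (2:ℝ) ^ a + y ^ a ≤ 1 + (1 + y) ^ a := by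
  have hc := convexOn_rpow ha
  have hy0 : 0 < y := by linarith
  have hs0 : 0 ≤ 1 / y := by positivity
  have hs1 : 0 ≤ 1 - 1 / y := by
    have : 1 / y ≤ 1 := by rw [div_le_one hy0]; exact hy
    linarith
  have m1 : (1:ℝ) ∈ Set.Ici (0:ℝ) := by simp
  have m2 : (1 + y) ∈ Set.Ici (0:ℝ) := by simp; linarith
  have h1 := hc.2 m1 m2 hs1 hs0 (by ring)
  have h2 := hc.2 m1 m2 hs0 hs1 (by ring)
  simp only [smul_eq_mul, Real.one_rpow] at h1 h2
  have e1 : (1 - 1 / y) * 1 + 1 / y * (1 + y) = 2 := by field_simp; ring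
  have e2 : 1 / y * 1 + (1 - 1 / y) * (1 + y) = y := by field_simp; ring
  rw [e1] at h1
  rw [e2] at h2
  linarith

/-- The function `h(y) = (1+y)^x - y^x + y^(-x) - m·x·y` is monotonically increasing on
`[1, ∞)` when `m ≥ 0` and `x ≥ 1 + log₂(m+2)`: for all `1 ≤ k ≤ t`,
`h(t) ≥ h(k)`. -/
theorem h_monotone_on_Ici_one (m x : ℝ) (hm : 0 ≤ m)
    (hx : 1 + Real.logb 2 (m + 2) ≤ x) :
    MonotoneOn (fun y : ℝ => (1 + y) ^ x - y ^ x + y ^ (-x) - m * x * y)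
      (Set.Ici (1 : ℝ)) ∧
    ∀ k t : ℝ, 1 ≤ k → k ≤ t →
      (1 + t) ^ x - t ^ x + t ^ (-x) - m * x * t ≥
        (1 + k) ^ x - k ^ x + k ^ (-x) - m * x * k := by
  have hp : m + 2 ≤ (2:ℝ) ^ (x - 1) :=
    (Real.logb_le_iff_le_rpow (by norm_num) (by linarith)).1 (by linarith)
  have ha : 1 ≤ x - 1 := by
    have h : (1:ℝ) ≤ Real.logb 2 (m + 2) := by
      rw [Real.le_logb_iff_rpow_le (by norm_num) (by linarith), Real.rpow_one]
      linarith
    linarith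
  have hd : ∀ y : ℝ, 1 ≤ y →
      HasDerivAt (fun y : ℝ => (1 + y) ^ x - y ^ x + y ^ (-x) - m * x * y)
        (1 * x * (1 + y) ^ (x - 1) - x * y ^ (x - 1) + (-x) * y ^ (-x - 1) - m * x * 1) y := by
    intro y hy
    have hy0 : y ≠ 0 := by linarith
    have hy1 : 1 + y ≠ 0 := by linarith
    exact (((((hasDerivAt_id y).const_add 1).rpow_const (Or.inl hy1)).sub
      (Real.hasDerivAt_rpow_const (Or.inl hy0))).add
      (Real.hasDerivAt_rpow_const (Or.inl hy0))).sub ((hasDerivAt_id y).const_mul (m * x))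
  have key : MonotoneOn (fun y : ℝ => (1 + y) ^ x - y ^ x + y ^ (-x) - m * x * y)
      (Set.Ici (1 : ℝ)) := by
    apply monotoneOn_of_deriv_nonneg (convex_Ici 1)
    · intro y hy
      exact (hd y hy).continuousAt.continuousWithinAt
    · intro y hy
      exact (hd y (interior_subset hy)).differentiableAt.differentiableWithinAt
    · intro y hy
      have hy1 : 1 ≤ y := interior_subset hy
      rw [(hd y hy1).deriv]
      have h1 := aux_incr (x - 1) y ha hy1
      have h2 : y ^ (-x - 1) ≤ 1 := Real.rpow_le_one_of_one_le_of_nonpos hy1 (by linarith)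
      have h3 : 0 ≤ x * ((1 + y) ^ (x - 1) - y ^ (x - 1) - y ^ (-x - 1) - m) :=
        mul_nonneg (by linarith) (by linarith)
      linarith
  exact ⟨key, fun k t hk hkt => key hk (le_trans hk hkt) hkt⟩
end

section
/- Let γ > 0, m ≥ 0, 0 < k ≤ 1, α ≥ (1 + log₂(m+2))·γ, and let N ≥ 4 and 1 ≤ n ≤ N−3. Let e_1, …, e_{N−1} > 0 and f_1, …, f_{N−1} > 0 be real numbers with f_{N−1} = e_{N−1} and satisfying the monogamy relations f_i^γ ≥ e_i^γ + f_{i+1}^γ for i = 1, …, N−2. Assume k·e_i^γ ≥ f_{i+1}^γ for i = 1, …, n and e_j^γ ≤ k·f_{j+1}^γ for j = n+1, …, N−2. Set M = ((1+k)^(α/γ) − 1)/k^(α/γ) + k^(α/γ), and for i = 1, …, n set M_i = M − f_{i+1}^α / e_i^α and T_i = (m·α/γ)·(e_i^γ / f_{i+1}^γ − 1/k), and for j = n+1, …, N−2 set Q_j = M − e_j^α / f_{j+1}^α and P_j = (m·α/γ)·(f_{j+1}^γ / e_j^γ − 1/k). Then f_1^α ≥ e_1^α + Σ_{i=1}^{n−1}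 ( Π_{j=1}^{i} (M_j + T_j) ) · e_{i+1}^α + ( Π_{i=1}^{n} (M_i + T_i) ) · ( e_{N−1}^α + Σ_{j=n+1}^{N−2} (Q_j + P_j) · e_j^α ). -/
/-- `(1+u)^p - u^p` is at least its value at `u = 1`. -/
lemma aux_pow_diff (p u : ℝ) (hp : 1 ≤ p) (hu : 1 ≤ u) :
    (2 : ℝ) ^ p - 1 ≤ (1 + u) ^ p - u ^ p := by
  have hd : ∀ x : ℝ, 1 ≤ x → HasDerivAt (fun x : ℝ => (1 + x) ^ p - x ^ p)
      (1 * p * (1 + x) ^ (p - 1) - 1 * p * x ^ (p - 1)) x := by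
    intro x hx
    exact (((hasDerivAt_id x).const_add 1).rpow_const (Or.inr hp)).sub
      ((hasDerivAt_id x).rpow_const (Or.inr hp))
  have hmono : MonotoneOn (fun x : ℝ => (1 + x) ^ p - x ^ p) (Set.Ici 1) := by
    apply monotoneOn_of_deriv_nonneg (convex_Ici 1)
    · intro x hx
      exact (hd x hx).continuousAt.continuousWithinAt
    · intro x hx
      exact (hd x (interior_subset hx)).differentiableAt.differentiableWithinAt
    · intro x hx
      have hx1 : (1 : ℝ) ≤ x := interior_subset hx
      rw [(hd x hx1).deriv]
      have : x ^ (p - 1) ≤ (1 + x) ^ (p - 1) :=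
        Real.rpow_le_rpow (by linarith) (by linarith) (by linarith)
      nlinarith
  have h := hmono (Set.mem_Ici.2 le_rfl) (Set.mem_Ici.2 hu) hu
  norm_num at h
  linarith

lemma aux_mono (s m : ℝ) (hs : 2 ≤ s) (hms : m + 2 ≤ (2 : ℝ) ^ (s - 1)) (v u : ℝ)
    (hv : 1 ≤ v) (hvu : v ≤ u) :
    (1 + v) ^ s - v ^ s + v ^ (-s) - m * s * v ≤ (1 + u) ^ s - u ^ s + u ^ (-s) - m * s * u := by
  have hd : ∀ x : ℝ, 1 ≤ x →
      HasDerivAt (fun x : ℝ => (1 + x) ^ s - x ^ s + x ^ (-s) - m * s * x)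
      (1 * s * (1 + x) ^ (s - 1) - 1 * s * x ^ (s - 1) + 1 * (-s) * x ^ (-s - 1) - m * s * 1) x := by
    intro x hx
    exact (((((hasDerivAt_id x).const_add 1).rpow_const (Or.inr (by linarith))).sub
      ((hasDerivAt_id x).rpow_const (Or.inr (by linarith)))).add
      ((hasDerivAt_id x).rpow_const (Or.inl (by simp only [id]; linarith)))).sub
      ((hasDerivAt_id x).const_mul (m * s))
  have hmono : MonotoneOn (fun x : ℝ => (1 + x) ^ s - x ^ s + x ^ (-s) - m * s * x)
      (Set.Ici 1) := by
    apply monotoneOn_of_deriv_nonneg (convex_Ici 1)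
    · intro x hx
      exact (hd x hx).continuousAt.continuousWithinAt
    · intro x hx
      exact (hd x (interior_subset hx)).differentiableAt.differentiableWithinAt
    · intro x hx
      have hx1 : (1 : ℝ) ≤ x := interior_subset hx
      rw [(hd x hx1).deriv]
      have h1 := aux_pow_diff (s - 1) x (by linarith) hx1
      have h2 : x ^ (-s - 1) ≤ 1 := Real.rpow_le_one_of_one_le_of_nonpos hx1 (by linarith)
      have h3 : 0 ≤ s * ((1 + x) ^ (s - 1) - x ^ (s - 1) - x ^ (-s - 1) - m) :=
        mul_nonneg (by linarith) (by linarith)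
      linarith
  exact hmono (Set.mem_Ici.2 hv) (Set.mem_Ici.2 (hv.trans hvu)) hvu

lemma aux_inv (s m t : ℝ) (ht : 0 < t) :
    (1 + 1 / t) ^ s - (1 / t) ^ s + (1 / t) ^ (-s) - m * s * (1 / t)
      = ((1 + t) ^ s - 1) / t ^ s + t ^ s - m * s * (1 / t) := by
  have h1 : (1 + 1 / t) = (1 + t) / t := by field_simp; ring
  have hp : 0 < t ^ s := Real.rpow_pos_of_pos ht s
  rw [h1, Real.div_rpow (by linarith) ht.le, Real.rpow_neg (by positivity), one_div,
    Real.inv_rpow ht.le, inv_inv]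
  ring

lemma aux_key (s m k t : ℝ) (hs : 2 ≤ s) (hms : m + 2 ≤ (2 : ℝ) ^ (s - 1))
    (ht : 0 < t) (htk : t ≤ k) (hk1 : k ≤ 1) :
    1 + ((((1 + k) ^ s - 1) / k ^ s + k ^ s - t ^ s) + m * s * (1 / t - 1 / k)) * t ^ s
      ≤ (1 + t) ^ s := by
  have hk : 0 < k := ht.trans_le htk
  have h := aux_mono s m hs hms (1 / k) (1 / t) (by rw [le_div_iff₀ hk]; linarith)
    (one_div_le_one_div_of_le ht htk)
  rw [aux_inv s m k hk, aux_inv s m t ht] at h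
  have hp : 0 < t ^ s := Real.rpow_pos_of_pos ht s
  have h2 : (((1 + k) ^ s - 1) / k ^ s + k ^ s - t ^ s) + m * s * (1 / t - 1 / k)
      ≤ ((1 + t) ^ s - 1) / t ^ s := by linarith
  rw [le_div_iff₀ hp] at h2
  linarith

lemma aux_nonneg (s m k t : ℝ) (hs : 2 ≤ s) (hm : 0 ≤ m)
    (ht : 0 < t) (htk : t ≤ k) :
    0 ≤ (((1 + k) ^ s - 1) / k ^ s + k ^ s - t ^ s) + m * s * (1 / t - 1 / k) := by
  have hk : 0 < k := ht.trans_le htk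
  have h1 : 1 ≤ (1 + k) ^ s := Real.one_le_rpow (by linarith) (by linarith)
  have h2 : 0 ≤ ((1 + k) ^ s - 1) / k ^ s :=
    div_nonneg (by linarith) (Real.rpow_pos_of_pos hk s).le
  have h3 : t ^ s ≤ k ^ s := Real.rpow_le_rpow ht.le htk (by linarith)
  have h4 : 0 ≤ m * s * (1 / t - 1 / k) :=
    mul_nonneg (mul_nonneg hm (by linarith)) (sub_nonneg.2 (one_div_le_one_div_of_le ht htk))
  linarith

/-- One step of the monogamy relation: `x` is the dominant term, `y` the other one. -/
lemma aux_step (γ m k α x y z : ℝ) (hγ : 0 < γ) (hm : 0 ≤ m) (hk1 : k ≤ 1)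
    (hs : 2 ≤ α / γ) (hms : m + 2 ≤ (2 : ℝ) ^ (α / γ - 1))
    (hx : 0 < x) (hy : 0 < y) (hz : 0 < z)
    (h : x ^ γ + y ^ γ ≤ z ^ γ) (hk : y ^ γ ≤ k * x ^ γ) :
    0 ≤ (((1 + k) ^ (α / γ) - 1) / k ^ (α / γ) + k ^ (α / γ) - y ^ α / x ^ α)
        + m * α / γ * (x ^ γ / y ^ γ - 1 / k) ∧
    x ^ α + ((((1 + k) ^ (α / γ) - 1) / k ^ (α / γ) + k ^ (α / γ) - y ^ α / x ^ α)
        + m * α / γ * (x ^ γ / y ^ γ - 1 / k)) * y ^ α ≤ z ^ α := by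
  have hX : 0 < x ^ γ := Real.rpow_pos_of_pos hx γ
  have hY : 0 < y ^ γ := Real.rpow_pos_of_pos hy γ
  have hXα : 0 < x ^ α := Real.rpow_pos_of_pos hx α
  have ht : 0 < y ^ γ / x ^ γ := div_pos hY hX
  have htk : y ^ γ / x ^ γ ≤ k := by rwa [div_le_iff₀ hX]
  have hpow : ∀ w : ℝ, 0 < w → (w ^ γ) ^ (α / γ) = w ^ α := by
    intro w hw
    rw [← Real.rpow_mul hw.le, mul_div_cancel₀ _ hγ.ne']
  have hts : (y ^ γ / x ^ γ) ^ (α / γ) = y ^ α / x ^ α := by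
    rw [Real.div_rpow hY.le hX.le, hpow x hx, hpow y hy]
  have hn := aux_nonneg (α / γ) m k _ hs hm ht htk
  have hK := aux_key (α / γ) m k _ hs hms ht htk hk1
  rw [hts, one_div_div, ← mul_div_assoc m α γ] at hn hK
  refine ⟨hn, ?_⟩
  have h1 : x ^ α * (1 + y ^ γ / x ^ γ) ^ (α / γ) ≤ z ^ α := by
    rw [← hpow x hx, ← Real.mul_rpow hX.le (by positivity), ← hpow z hz]
    apply Real.rpow_le_rpow (by positivity) _ (by linarith)
    rw [mul_add, mul_div_cancel₀ _ hX.ne']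
    linarith
  have h2 := mul_le_mul_of_nonneg_left hK hXα.le
  refine le_trans (le_of_eq ?_) (h2.trans h1)
  generalize hC : (((1 + k) ^ (α / γ) - 1) / k ^ (α / γ) + k ^ (α / γ) - y ^ α / x ^ α)
        + m * α / γ * (x ^ γ / y ^ γ - 1 / k) = C
  field_simp

lemma aux_chain1 (a b C : ℕ → ℝ) (n : ℕ)
    (hC : ∀ i, 1 ≤ i → i ≤ n + 1 → 0 ≤ C i ∧ a i + C i * b (i + 1) ≤ b i) :
    a 1 + ∑ i ∈ Finset.Icc 1 n, (∏ j ∈ Finset.Icc 1 i, C j) * a (i + 1)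
      + (∏ j ∈ Finset.Icc 1 (n + 1), C j) * b (n + 2) ≤ b 1 := by
  induction n with
  | zero => simpa using (hC 1 le_rfl le_rfl).2
  | succ n ih =>
    have h := ih (fun i h1 h2 => hC i h1 (by omega))
    have h2 := (hC (n + 2) (by omega) (by omega)).2
    have hP : 0 ≤ ∏ j ∈ Finset.Icc 1 (n + 1), C j :=
      Finset.prod_nonneg fun j hj => by
        rw [Finset.mem_Icc] at hj
        exact (hC j hj.1 (by omega)).1
    have h3 := mul_le_mul_of_nonneg_left h2 hP
    rw [Finset.sum_Icc_succ_top (by omega), Finset.prod_Icc_succ_top (b := n + 1) (by omega)]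
    have e1 : n + 1 + 1 = n + 2 := rfl
    have e2 : n + 2 + 1 = n + 3 := rfl
    have e3 : n + 1 + 2 = n + 3 := rfl
    rw [e1, e3]
    rw [e2] at h3
    linarith

lemma aux_chain2 (a b D : ℕ → ℝ) (n r : ℕ)
    (hD : ∀ j, n + 1 ≤ j → j ≤ n + r → b (j + 1) + D j * a j ≤ b j) :
    b (n + r + 1) + ∑ j ∈ Finset.Icc (n + 1) (n + r), D j * a j ≤ b (n + 1) := by
  induction r with
  | zero => simp
  | succ r ih =>
    have h := ih (fun j h1 h2 => hD j h1 (by omega))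
    have h2 := hD (n + r + 1) (by omega) (by omega)
    have e1 : n + (r + 1) = n + r + 1 := rfl
    rw [e1, Finset.sum_Icc_succ_top (by omega)]
    linarith

/-- Theorem 3.3: tighter α-th monogamy relation for N-partite states, where the
subsystems split into two groups according to the ratio condition. Here `e i` plays
the role of `E(ρ_{A B_i})` and `f i` that of `E(ρ_{A|B_i ⋯ B_{N-1}})`. -/
theorem tighter_monogamy_multipartite (γ m k α : ℝ) (N n : ℕ) (e f : ℕ → ℝ)
    (hγ : 0 < γ) (hm : 0 ≤ m) (hk0 : 0 < k) (hk1 : k ≤ 1)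
    (hα : (1 + Real.logb 2 (m + 2)) * γ ≤ α)
    (hN : 4 ≤ N) (hn1 : 1 ≤ n) (hn2 : n ≤ N - 3)
    (hepos : ∀ i, 1 ≤ i → i ≤ N - 1 → 0 < e i)
    (hfpos : ∀ i, 1 ≤ i → i ≤ N - 1 → 0 < f i)
    (hlast : f (N - 1) = e (N - 1))
    (hmono : ∀ i, 1 ≤ i → i ≤ N - 2 → f i ^ γ ≥ e i ^ γ + f (i + 1) ^ γ)
    (hgrp1 : ∀ i, 1 ≤ i → i ≤ n → k * e i ^ γ ≥ f (i + 1) ^ γ)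
    (hgrp2 : ∀ j, n + 1 ≤ j → j ≤ N - 2 → e j ^ γ ≤ k * f (j + 1) ^ γ) :
    f 1 ^ α ≥
      e 1 ^ α
      + ∑ i ∈ Finset.Icc 1 (n - 1),
          (∏ j ∈ Finset.Icc 1 i,
            ((((1 + k) ^ (α / γ) - 1) / k ^ (α / γ) + k ^ (α / γ)
                - f (j + 1) ^ α / e j ^ α)
              + m * α / γ * (e j ^ γ / f (j + 1) ^ γ - 1 / k))) * e (i + 1) ^ α
      + (∏ i ∈ Finset.Icc 1 n,
          ((((1 + k) ^ (α / γ) - 1) / k ^ (α / γ) + k ^ (α / γ)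
              - f (i + 1) ^ α / e i ^ α)
            + m * α / γ * (e i ^ γ / f (i + 1) ^ γ - 1 / k)))
        * (e (N - 1) ^ α
          + ∑ j ∈ Finset.Icc (n + 1) (N - 2),
              ((((1 + k) ^ (α / γ) - 1) / k ^ (α / γ) + k ^ (α / γ)
                  - e j ^ α / f (j + 1) ^ α)
                + m * α / γ * (f (j + 1) ^ γ / e j ^ γ - 1 / k)) * e j ^ α) := by
  have hlog : 1 ≤ Real.logb 2 (m + 2) := by
    rw [Real.le_logb_iff_rpow_le (by norm_num) (by linarith)]
    norm_num
    linarith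
  have hsl : 1 + Real.logb 2 (m + 2) ≤ α / γ := by rwa [le_div_iff₀ hγ]
  have hs : 2 ≤ α / γ := by linarith
  have hms : m + 2 ≤ (2 : ℝ) ^ (α / γ - 1) := by
    rw [← Real.logb_le_iff_le_rpow (by norm_num) (by linarith)]
    linarith
  obtain ⟨p, rfl⟩ : ∃ p, n = p + 1 := ⟨n - 1, by omega⟩
  obtain ⟨r, rfl⟩ : ∃ r, N = p + 1 + r + 2 := ⟨N - (p + 3), by omega⟩
  have e1 : p + 1 + r + 2 - 1 = p + 1 + r + 1 := by omega
  have e2 : p + 1 + r + 2 - 2 = p + 1 + r := by omega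
  have e3 : p + 1 - 1 = p := by omega
  rw [e1] at hepos hfpos hlast
  rw [e2] at hmono hgrp2
  rw [e1, e2, e3]
  have h1 := aux_chain1 (fun i => e i ^ α) (fun i => f i ^ α)
    (fun j => ((((1 + k) ^ (α / γ) - 1) / k ^ (α / γ) + k ^ (α / γ)
                - f (j + 1) ^ α / e j ^ α)
              + m * α / γ * (e j ^ γ / f (j + 1) ^ γ - 1 / k))) p
    (fun i hi1 hi2 => aux_step γ m k α (e i) (f (i + 1)) (f i) hγ hm hk1 hs hms
      (hepos i hi1 (by omega)) (hfpos (i + 1) (by omega) (by omega)) (hfpos i hi1 (by omega))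
      (hmono i hi1 (by omega)) (hgrp1 i hi1 hi2))
  have h2 := aux_chain2 (fun i => e i ^ α) (fun i => f i ^ α)
    (fun j => ((((1 + k) ^ (α / γ) - 1) / k ^ (α / γ) + k ^ (α / γ)
                  - e j ^ α / f (j + 1) ^ α)
                + m * α / γ * (f (j + 1) ^ γ / e j ^ γ - 1 / k))) (p + 1) r
    (fun j hj1 hj2 => (aux_step γ m k α (f (j + 1)) (e j) (f j) hγ hm hk1 hs hms
      (hfpos (j + 1) (by omega) (by omega)) (hepos j (by omega) (by omega))
      (hfpos j (by omega) (by omega))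
      (by have := hmono j (by omega) hj2; linarith) (hgrp2 j hj1 hj2)).2)
  have hP : 0 ≤ ∏ j ∈ Finset.Icc 1 (p + 1),
      ((((1 + k) ^ (α / γ) - 1) / k ^ (α / γ) + k ^ (α / γ)
                - f (j + 1) ^ α / e j ^ α)
              + m * α / γ * (e j ^ γ / f (j + 1) ^ γ - 1 / k)) :=
    Finset.prod_nonneg fun i hi => by
      rw [Finset.mem_Icc] at hi
      exact (aux_step γ m k α (e i) (f (i + 1)) (f i) hγ hm hk1 hs hms
        (hepos i hi.1 (by omega)) (hfpos (i + 1) (by omega) (by omega))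
        (hfpos i hi.1 (by omega))
        (hmono i hi.1 (by omega)) (hgrp1 i hi.1 hi.2)).1
  rw [hlast] at h2
  have h3 := mul_le_mul_of_nonneg_left h2 hP
  exact (add_le_add_right h3 _).trans h1
end

section
/- Let m ≥ 0 and x ≥ 1 + log₂(m+2). Let N ≥ 1 and let p_1 ≥ p_2 ≥ ⋯ ≥ p_N > 0 be real numbers, and write S_i = p_1 + ⋯ + p_i for the partial sums. Then (Σ_{i=1}^{N} p_i)^x ≥ Σ_{i=1}^{N} ( i^x − (i−1)^x )·p_i^x + Σ_{i=2}^{N} ( (i−1)^(−x) − (S_{i−1}/p_i)^(−x) )·p_i^x + m·x·Σ_{i=2}^{N} ( S_{i−1}/p_i − (i−1) )·p_i^x. -/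
lemma aux_inc (y t : ℝ) (hy : 1 ≤ y) (ht : 1 ≤ t) : (2:ℝ)^y - 1 ≤ (1+t)^y - t^y := by
  have hd : ∀ s ∈ Set.Ici (1:ℝ), HasDerivAt (fun s : ℝ => (1+s)^y - s^y)
      (y * (1+s)^(y-1) - y * s^(y-1)) s := by
    intro s hs
    have hs : (1:ℝ) ≤ s := hs
    have h1 := ((hasDerivAt_id s).const_add 1).rpow_const (p := y) (Or.inr hy)
    have h2 := (hasDerivAt_id s).rpow_const (p := y) (Or.inr hy)
    exact (h1.sub h2).congr_deriv (by simp)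
  have hmono : MonotoneOn (fun s : ℝ => (1+s)^y - s^y) (Set.Ici 1) := by
    apply monotoneOn_of_hasDerivWithinAt_nonneg (convex_Ici 1)
      (fun s hs => (hd s hs).continuousAt.continuousWithinAt)
      (fun s hs => (hd s (interior_subset hs)).hasDerivWithinAt)
    intro s hs
    have hs : (1:ℝ) ≤ s := interior_subset hs
    have : s^(y-1) ≤ (1+s)^(y-1) :=
      Real.rpow_le_rpow (by linarith) (by linarith) (by linarith)
    nlinarith
  have := hmono (Set.mem_Ici.2 le_rfl) (Set.mem_Ici.2 ht) ht
  norm_num at this ⊢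
  linarith

lemma aux_key_s14 (m x k t : ℝ) (hm : 0 ≤ m) (hx : 1 + Real.logb 2 (m + 2) ≤ x)
    (hk : 1 ≤ k) (hkt : k ≤ t) :
    t^x + (1+k)^x - k^x + k^(-x) - t^(-x) + m * x * (t-k) ≤ (1+t)^x := by
  have hpow : m + 2 ≤ (2:ℝ)^(x-1) := by
    rw [← Real.logb_le_iff_le_rpow (by norm_num) (by linarith)]
    linarith
  have hlog : 1 ≤ Real.logb 2 (m+2) := by
    rw [Real.le_logb_iff_rpow_le (by norm_num) (by linarith)]
    norm_num; exact hm
  have hx2 : 2 ≤ x := by linarith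
  have hd : ∀ s ∈ Set.Ici (1:ℝ),
      HasDerivAt (fun s : ℝ => (1+s)^x - s^x + s^(-x) - m * x * s)
      (x * (1+s)^(x-1) - x * s^(x-1) + (-x) * s^(-x-1) - m * x) s := by
    intro s hs
    have hs : (1:ℝ) ≤ s := hs
    have h1 := ((hasDerivAt_id s).const_add 1).rpow_const (p := x) (Or.inr (by linarith))
    have h2 := (hasDerivAt_id s).rpow_const (p := x) (Or.inr (by linarith))
    have h3 := (hasDerivAt_id s).rpow_const (p := -x) (Or.inl (by simp; linarith))
    have h4 := (hasDerivAt_id s).const_mul (m * x)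
    exact (((h1.sub h2).add h3).sub h4).congr_deriv (by simp)
  have hmono : MonotoneOn (fun s : ℝ => (1+s)^x - s^x + s^(-x) - m * x * s) (Set.Ici 1) := by
    apply monotoneOn_of_hasDerivWithinAt_nonneg (convex_Ici 1)
      (fun s hs => (hd s hs).continuousAt.continuousWithinAt)
      (fun s hs => (hd s (interior_subset hs)).hasDerivWithinAt)
    intro s hs
    have hs : (1:ℝ) ≤ s := interior_subset hs
    have h1 := aux_inc (x-1) s (by linarith) hs
    have h2 : s^(-x-1) ≤ 1 := Real.rpow_le_one_of_one_le_of_nonpos hs (by linarith)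
    have h3 : 0 ≤ x * ((1+s)^(x-1) - s^(x-1) - s^(-x-1) - m) :=
      mul_nonneg (by linarith) (by linarith)
    linarith
  have := hmono (Set.mem_Ici.2 hk) (Set.mem_Ici.2 (hk.trans hkt)) hkt
  simp only at this
  linarith

/-- Lemma 3.5: parametrized lower bound for the x-th power of a sum of N decreasing
positive numbers, where `S_{i-1} = p_1 + ⋯ + p_{i-1}` denotes the partial sums
(by convention the `i = 1` term of the first sum is `(1^x - 0^x)·p_1^x = p_1^x`). -/
theorem power_of_sum_bound (m x : ℝ) (N : ℕ) (p : ℕ → ℝ) (hm : 0 ≤ m)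
    (hx : 1 + Real.logb 2 (m + 2) ≤ x)
    (hN : 1 ≤ N)
    (hpos : ∀ i, 1 ≤ i → i ≤ N → 0 < p i)
    (hdec : ∀ i, 1 ≤ i → i + 1 ≤ N → p (i + 1) ≤ p i) :
    (∑ i ∈ Finset.Icc 1 N, p i) ^ x ≥
      ∑ i ∈ Finset.Icc 1 N, ((i : ℝ) ^ x - ((i : ℝ) - 1) ^ x) * p i ^ x
      + ∑ i ∈ Finset.Icc 2 N,
          (((i : ℝ) - 1) ^ (-x)
            - ((∑ j ∈ Finset.Icc 1 (i - 1), p j) / p i) ^ (-x)) * p i ^ x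
      + m * x * ∑ i ∈ Finset.Icc 2 N,
          ((∑ j ∈ Finset.Icc 1 (i - 1), p j) / p i - ((i : ℝ) - 1)) * p i ^ x := by
  have hle : ∀ n, 1 ≤ n → n ≤ N → ∀ j, 1 ≤ j → j ≤ n → p n ≤ p j := by
    intro n hn
    induction n, hn using Nat.le_induction with
    | base =>
      intro _ j h1 h2
      have : j = 1 := by omega
      rw [this]
    | succ n hn ih =>
      intro hnN j h1 h2
      rcases Nat.lt_or_ge n j with h | h
      · have : j = n + 1 := by omega
        rw [this]
      · exact (hdec n hn hnN).trans (ih (by omega) j h1 h)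
  suffices H : ∀ n, 1 ≤ n → n ≤ N → (∑ i ∈ Finset.Icc 1 n, p i) ^ x ≥
      ∑ i ∈ Finset.Icc 1 n, ((i : ℝ) ^ x - ((i : ℝ) - 1) ^ x) * p i ^ x
      + ∑ i ∈ Finset.Icc 2 n,
          (((i : ℝ) - 1) ^ (-x)
            - ((∑ j ∈ Finset.Icc 1 (i - 1), p j) / p i) ^ (-x)) * p i ^ x
      + m * x * ∑ i ∈ Finset.Icc 2 n,
          ((∑ j ∈ Finset.Icc 1 (i - 1), p j) / p i - ((i : ℝ) - 1)) * p i ^ x from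
    H N hN le_rfl
  have hlog : 0 ≤ Real.logb 2 (m+2) := Real.logb_nonneg (by norm_num) (by linarith)
  have hx0 : x ≠ 0 := by linarith
  intro n hn
  induction n, hn using Nat.le_induction with
  | base =>
    intro _
    simp [Real.zero_rpow hx0]
  | succ n hn ih =>
    intro hnN
    have ih := ih (by omega)
    have hp := hpos (n+1) (by omega) hnN
    rw [Finset.sum_Icc_succ_top (by omega), Finset.sum_Icc_succ_top (by omega),
      Finset.sum_Icc_succ_top (by omega), Finset.sum_Icc_succ_top (by omega)]
    simp only [Nat.add_sub_cancel]
    push_cast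
    rw [add_sub_cancel_right]
    have hS : (n:ℝ) * p (n+1) ≤ ∑ j ∈ Finset.Icc 1 n, p j := by
      have := Finset.card_nsmul_le_sum (Finset.Icc 1 n) p (p (n+1)) (fun j hj => by
        rw [Finset.mem_Icc] at hj
        exact hle (n+1) (by omega) hnN j hj.1 (by omega))
      simpa using this
    set S := ∑ j ∈ Finset.Icc 1 n, p j with hSdef
    have hn1 : (1:ℝ) ≤ n := by exact_mod_cast hn
    have ht : (n:ℝ) ≤ S / p (n+1) := (le_div_iff₀ hp).2 hS
    have key := aux_key_s14 m x n (S / p (n+1)) hm hx hn1 ht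
    have hP : 0 < p (n+1) ^ x := Real.rpow_pos_of_pos hp x
    have e1 : (S / p (n+1)) ^ x * p (n+1) ^ x = S ^ x := by
      rw [← Real.mul_rpow (by linarith) hp.le, div_mul_cancel₀ _ hp.ne']
    have e2 : (1 + S / p (n+1)) ^ x * p (n+1) ^ x = (S + p (n+1)) ^ x := by
      rw [← Real.mul_rpow (by linarith) hp.le, add_mul, div_mul_cancel₀ _ hp.ne', one_mul,
        add_comm]
    have key2 := mul_le_mul_of_nonneg_right key hP.le
    rw [e2] at key2
    rw [add_comm (n:ℝ) 1]
    linarith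
end

section
/- Let γ > 0, m ≥ 0, and α ≥ (1 + log₂(m+2))·γ. Let N ≥ 2, a ≥ 0, and e_1 ≥ e_2 ≥ ⋯ ≥ e_{N−1} > 0 be real numbers with a^γ ≥ Σ_{i=1}^{N−1} e_i^γ, and for i = 2, …, N−1 set τ_i = (e_1^γ + ⋯ + e_{i−1}^γ)/e_i^γ. Then the following chain holds: a^α ≥ e_1^α + Σ_{i=2}^{N−1} [ i^(α/γ) − (i−1)^(α/γ) + (i−1)^(−α/γ) − τ_i^(−α/γ) + (m·α/γ)(τ_i − (i−1)) ]·e_i^α ≥ e_1^α + Σ_{i=2}^{N−1} [ i^(α/γ) − (i−1)^(α/γ) + (i−1)^(−α/γ) − τ_i^(−α/γ) ]·e_i^α ≥ e_1^α + Σ_{i=2}^{N−1} [ i^(α/γ) − (i−1)^(α/γ) ]·e_i^α ≥ e_1^α + Σ_{i=2}^{N−1} (2^(α/γ) − 1)·e_i^α ≥ Σ_{i=1}^{N−1} e_i^α. -/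
/-- The increment `(1+t)^p - t^p` is monotone on `[1, ∞)` for `p ≥ 1`. -/
theorem aux_incr_s16 (p : ℝ) (hp : 1 ≤ p) :
    MonotoneOn (fun t : ℝ => (1 + t) ^ p - t ^ p) (Set.Ici 1) := by
  have hd : ∀ t : ℝ, 0 < t → HasDerivAt (fun t : ℝ => (1 + t) ^ p - t ^ p)
      (1 * p * (1 + t) ^ (p - 1) - 1 * p * t ^ (p - 1)) t := by
    intro t ht
    have h1 : HasDerivAt (fun t : ℝ => 1 + t) 1 t := (hasDerivAt_id t).const_add 1
    have h2 : HasDerivAt (fun t : ℝ => t) 1 t := hasDerivAt_id t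
    exact (h1.rpow_const (Or.inr hp)).sub (h2.rpow_const (Or.inr hp))
  apply monotoneOn_of_deriv_nonneg (convex_Ici 1)
  · intro t ht
    have ht' : (1 : ℝ) ≤ t := ht
    exact (hd t (by linarith)).continuousAt.continuousWithinAt
  · intro t ht
    rw [interior_Ici] at ht
    have ht' : (1 : ℝ) < t := ht
    exact (hd t (by linarith)).differentiableAt.differentiableWithinAt
  · intro t ht
    rw [interior_Ici] at ht
    have ht' : (1 : ℝ) < t := ht
    rw [(hd t (by linarith)).deriv]
    have : t ^ (p - 1) ≤ (1 + t) ^ (p - 1) :=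
      Real.rpow_le_rpow (by linarith) (by linarith) (by linarith)
    nlinarith

theorem aux_incr_one (p t : ℝ) (hp : 1 ≤ p) (ht : 1 ≤ t) :
    (2 : ℝ) ^ p - 1 ≤ (1 + t) ^ p - t ^ p := by
  have h := aux_incr_s16 p hp (Set.mem_Ici.2 le_rfl) (Set.mem_Ici.2 ht) ht
  simp only [Real.one_rpow] at h
  norm_num at h
  linarith

/-- Monotonicity behind the parametrized bound. -/
theorem aux_main (x m : ℝ) (hm : 0 ≤ m) (hx : 2 ≤ x) (h2 : m + 2 ≤ (2 : ℝ) ^ (x - 1)) :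
    MonotoneOn (fun t : ℝ => (1 + t) ^ x - t ^ x + t ^ (-x) - m * x * t) (Set.Ici 1) := by
  have hd : ∀ t : ℝ, 0 < t →
      HasDerivAt (fun t : ℝ => (1 + t) ^ x - t ^ x + t ^ (-x) - m * x * t)
      (1 * x * (1 + t) ^ (x - 1) - 1 * x * t ^ (x - 1) + 1 * (-x) * t ^ (-x - 1)
        - m * x * 1) t := by
    intro t ht
    have h1 : HasDerivAt (fun t : ℝ => 1 + t) 1 t := (hasDerivAt_id t).const_add 1
    have h2 : HasDerivAt (fun t : ℝ => t) 1 t := hasDerivAt_id t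
    have hp : 1 ≤ x := by linarith
    exact (((h1.rpow_const (Or.inr hp)).sub (h2.rpow_const (Or.inr hp))).add
      (h2.rpow_const (Or.inl ht.ne'))).sub (h2.const_mul (m * x))
  apply monotoneOn_of_deriv_nonneg (convex_Ici 1)
  · intro t ht
    have ht' : (1 : ℝ) ≤ t := ht
    exact (hd t (by linarith)).continuousAt.continuousWithinAt
  · intro t ht
    rw [interior_Ici] at ht
    have ht' : (1 : ℝ) < t := ht
    exact (hd t (by linarith)).differentiableAt.differentiableWithinAt
  · intro t ht
    rw [interior_Ici] at ht
    have ht' : (1 : ℝ) < t := ht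
    rw [(hd t (by linarith)).deriv]
    have h3 := aux_incr_one (x - 1) t (by linarith) ht'.le
    have h4 : t ^ (-x - 1) ≤ 1 :=
      Real.rpow_le_one_of_one_le_of_nonpos ht'.le (by linarith)
    have h5 : 0 ≤ x * ((1 + t) ^ (x - 1) - t ^ (x - 1) - t ^ (-x - 1) - m) :=
      mul_nonneg (by linarith) (by linarith)
    linarith

/-- Corollary 3.7: comparison chain showing the parametrized multipartite bound is
tighter than previously known bounds. Here `a` plays the role of
`E(ρ_{A|B_1 ⋯ B_{N-1}})`, the `e i` are in descending order, and
`τ_i = (e_1^γ + ⋯ + e_{i-1}^γ)/e_i^γ`. -/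
theorem tighter_monogamy_descending_chain (γ m α a : ℝ) (N : ℕ) (e : ℕ → ℝ)
    (hγ : 0 < γ) (hm : 0 ≤ m)
    (hα : (1 + Real.logb 2 (m + 2)) * γ ≤ α)
    (hN : 2 ≤ N) (ha : 0 ≤ a)
    (hpos : ∀ i, 1 ≤ i → i ≤ N - 1 → 0 < e i)
    (hdec : ∀ i, 1 ≤ i → i + 1 ≤ N - 1 → e (i + 1) ≤ e i)
    (hmono : a ^ γ ≥ ∑ i ∈ Finset.Icc 1 (N - 1), e i ^ γ) :
    a ^ α ≥
        e 1 ^ α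
        + ∑ i ∈ Finset.Icc 2 (N - 1),
            ((i : ℝ) ^ (α / γ) - ((i : ℝ) - 1) ^ (α / γ)
              + ((i : ℝ) - 1) ^ (-(α / γ))
              - ((∑ j ∈ Finset.Icc 1 (i - 1), e j ^ γ) / e i ^ γ) ^ (-(α / γ))
              + m * α / γ
                * ((∑ j ∈ Finset.Icc 1 (i - 1), e j ^ γ) / e i ^ γ - ((i : ℝ) - 1)))
            * e i ^ α ∧
    e 1 ^ α
        + ∑ i ∈ Finset.Icc 2 (N - 1),
            ((i : ℝ) ^ (α / γ) - ((i : ℝ) - 1) ^ (α / γ)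
              + ((i : ℝ) - 1) ^ (-(α / γ))
              - ((∑ j ∈ Finset.Icc 1 (i - 1), e j ^ γ) / e i ^ γ) ^ (-(α / γ))
              + m * α / γ
                * ((∑ j ∈ Finset.Icc 1 (i - 1), e j ^ γ) / e i ^ γ - ((i : ℝ) - 1)))
            * e i ^ α ≥
      e 1 ^ α
        + ∑ i ∈ Finset.Icc 2 (N - 1),
            ((i : ℝ) ^ (α / γ) - ((i : ℝ) - 1) ^ (α / γ)
              + ((i : ℝ) - 1) ^ (-(α / γ))
              - ((∑ j ∈ Finset.Icc 1 (i - 1), e j ^ γ) / e i ^ γ) ^ (-(α / γ)))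
            * e i ^ α ∧
    e 1 ^ α
        + ∑ i ∈ Finset.Icc 2 (N - 1),
            ((i : ℝ) ^ (α / γ) - ((i : ℝ) - 1) ^ (α / γ)
              + ((i : ℝ) - 1) ^ (-(α / γ))
              - ((∑ j ∈ Finset.Icc 1 (i - 1), e j ^ γ) / e i ^ γ) ^ (-(α / γ)))
            * e i ^ α ≥
      e 1 ^ α
        + ∑ i ∈ Finset.Icc 2 (N - 1),
            ((i : ℝ) ^ (α / γ) - ((i : ℝ) - 1) ^ (α / γ)) * e i ^ α ∧
    e 1 ^ α
        + ∑ i ∈ Finset.Icc 2 (N - 1),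
            ((i : ℝ) ^ (α / γ) - ((i : ℝ) - 1) ^ (α / γ)) * e i ^ α ≥
      e 1 ^ α + ∑ i ∈ Finset.Icc 2 (N - 1), ((2 : ℝ) ^ (α / γ) - 1) * e i ^ α ∧
    e 1 ^ α + ∑ i ∈ Finset.Icc 2 (N - 1), ((2 : ℝ) ^ (α / γ) - 1) * e i ^ α ≥
      ∑ i ∈ Finset.Icc 1 (N - 1), e i ^ α := by
  have hγ0 : γ ≠ 0 := hγ.ne'
  obtain ⟨x, hxdef⟩ : ∃ x, x = α / γ := ⟨_, rfl⟩
  have hαx : α = γ * x := by rw [hxdef]; field_simp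
  have hxl : 1 + Real.logb 2 (m + 2) ≤ x := by
    rw [hxdef, le_div_iff₀ hγ]; exact hα
  have hlog : 1 ≤ Real.logb 2 (m + 2) := by
    rw [Real.le_logb_iff_rpow_le (by norm_num) (by linarith)]
    simp; exact hm
  have hx : 2 ≤ x := by linarith
  have h2 : m + 2 ≤ (2 : ℝ) ^ (x - 1) := by
    rw [← Real.logb_le_iff_le_rpow (by norm_num) (by linarith)]
    linarith
  have hmx : m * α / γ = m * x := by rw [hxdef]; ring
  rw [← hxdef, hmx]
  have hpα : ∀ i ∈ Finset.Icc 2 (N - 1), 0 ≤ e i ^ α := by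
    intro i hi
    rw [Finset.mem_Icc] at hi
    exact Real.rpow_nonneg (hpos i (by omega) hi.2).le _
  have hanti : ∀ i, 1 ≤ i → i ≤ N - 1 → ∀ j, 1 ≤ j → j ≤ i → e i ≤ e j := by
    intro i hi
    induction i, hi using Nat.le_induction with
    | base =>
      intro _ j h1 h3
      have : j = 1 := by omega
      rw [this]
    | succ n hn ih =>
      intro hnN j h1 h3
      rcases Nat.lt_or_ge n j with h | h
      · have : j = n + 1 := by omega
        rw [this]
      · exact (hdec n hn hnN).trans (ih (by omega) j h1 h)
  have hτ : ∀ i, 2 ≤ i → i ≤ N - 1 →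
      (i : ℝ) - 1 ≤ (∑ j ∈ Finset.Icc 1 (i - 1), e j ^ γ) / e i ^ γ := by
    intro i hi hiN
    have hei := hpos i (by omega) hiN
    rw [le_div_iff₀ (Real.rpow_pos_of_pos hei _)]
    have h : ∑ j ∈ Finset.Icc 1 (i - 1), e i ^ γ ≤ ∑ j ∈ Finset.Icc 1 (i - 1), e j ^ γ := by
      apply Finset.sum_le_sum
      intro j hj
      rw [Finset.mem_Icc] at hj
      exact Real.rpow_le_rpow hei.le (hanti i (by omega) hiN j hj.1 (by omega)) hγ.le
    rw [Finset.sum_const, Nat.card_Icc, nsmul_eq_mul] at h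
    have hc : ((i - 1 + 1 - 1 : ℕ) : ℝ) = (i : ℝ) - 1 := by
      rw [Nat.add_sub_cancel, Nat.cast_sub (by omega)]; simp
    rwa [hc] at h
  have hi1 : ∀ i : ℕ, 2 ≤ i → (1 : ℝ) ≤ (i : ℝ) - 1 := by
    intro i hi
    have : (2 : ℝ) ≤ (i : ℝ) := by exact_mod_cast hi
    linarith
  refine ⟨?_, ?_, ?_, ?_, ?_⟩
  · have key : ∀ n, 1 ≤ n → n ≤ N - 1 →
        e 1 ^ α + ∑ i ∈ Finset.Icc 2 n,
            ((i : ℝ) ^ x - ((i : ℝ) - 1) ^ x + ((i : ℝ) - 1) ^ (-x)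
              - ((∑ j ∈ Finset.Icc 1 (i - 1), e j ^ γ) / e i ^ γ) ^ (-x)
              + m * x * ((∑ j ∈ Finset.Icc 1 (i - 1), e j ^ γ) / e i ^ γ - ((i : ℝ) - 1)))
            * e i ^ α ≤ (∑ j ∈ Finset.Icc 1 n, e j ^ γ) ^ x := by
      intro n hn
      induction n, hn using Nat.le_induction with
      | base =>
        intro h1
        simp
        rw [hαx, Real.rpow_mul (hpos 1 le_rfl h1).le]
      | succ n hn ih =>
        intro hnN
        have ih' := ih (by omega)
        rw [Finset.sum_Icc_succ_top (by omega), Finset.sum_Icc_succ_top (by omega : 1 ≤ n + 1)]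
        have ht := hτ (n + 1) (by omega) hnN
        have hk := hi1 (n + 1) (by omega)
        have hen := hpos (n + 1) (by omega) hnN
        rw [Nat.add_sub_cancel] at ht ⊢
        set S := ∑ j ∈ Finset.Icc 1 n, e j ^ γ with hS
        set E := e (n + 1) ^ γ with hE
        have hEpos : 0 < E := Real.rpow_pos_of_pos hen _
        set k : ℝ := ((n + 1 : ℕ) : ℝ) - 1 with hkd
        have hnk : ((n + 1 : ℕ) : ℝ) = 1 + k := by rw [hkd]; ring
        rw [hnk]
        set t := S / E with htd
        have hSt : S = t * E := by rw [htd]; field_simp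
        have hmon := aux_main x m hm hx h2 (Set.mem_Ici.2 hk) (Set.mem_Ici.2 (hk.trans ht)) ht
        simp only at hmon
        have hEα : e (n + 1) ^ α = E ^ x := by rw [hE, hαx, Real.rpow_mul hen.le]
        have hSx : S ^ x = t ^ x * E ^ x := by
          rw [hSt, Real.mul_rpow (by linarith) hEpos.le]
        have hSEx : (S + E) ^ x = (1 + t) ^ x * E ^ x := by
          rw [← Real.mul_rpow (by linarith) hEpos.le, hSt]
          congr 1; ring
        rw [hEα, hSEx]
        rw [hSx] at ih'
        have hEx : 0 ≤ E ^ x := Real.rpow_nonneg hEpos.le _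
        have := mul_le_mul_of_nonneg_right
          (show (1 + k) ^ x - k ^ x + k ^ (-x) - t ^ (-x) + m * x * (t - k)
            ≤ (1 + t) ^ x - t ^ x by linarith) hEx
        linarith
    refine (key (N - 1) (by omega) le_rfl).trans ?_
    rw [hαx, Real.rpow_mul ha]
    refine Real.rpow_le_rpow ?_ hmono (by linarith)
    apply Finset.sum_nonneg
    intro i hi
    rw [Finset.mem_Icc] at hi
    exact Real.rpow_nonneg (hpos i hi.1 hi.2).le _
  · apply add_le_add_right
    apply Finset.sum_le_sum
    intro i hi
    apply mul_le_mul_of_nonneg_right _ (hpα i hi)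
    rw [Finset.mem_Icc] at hi
    have := mul_nonneg (mul_nonneg hm (by linarith : 0 ≤ x)) (sub_nonneg.2 (hτ i hi.1 hi.2))
    linarith
  · apply add_le_add_right
    apply Finset.sum_le_sum
    intro i hi
    apply mul_le_mul_of_nonneg_right _ (hpα i hi)
    rw [Finset.mem_Icc] at hi
    have h1 := hi1 i hi.1
    have := Real.rpow_le_rpow_of_nonpos (z := -x) (by linarith) (hτ i hi.1 hi.2) (by linarith)
    linarith
  · apply add_le_add_right
    apply Finset.sum_le_sum
    intro i hi
    apply mul_le_mul_of_nonneg_right _ (hpα i hi)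
    rw [Finset.mem_Icc] at hi
    have := aux_incr_one x ((i : ℝ) - 1) (by linarith) (hi1 i hi.1)
    rwa [add_sub_cancel] at this
  · have hsplit : ∑ i ∈ Finset.Icc 1 (N - 1), e i ^ α
        = e 1 ^ α + ∑ i ∈ Finset.Icc 2 (N - 1), e i ^ α := by
      rw [← Finset.add_sum_Ioc_eq_sum_Icc (by omega)]
      rfl
    rw [hsplit]
    apply add_le_add_right
    apply Finset.sum_le_sum
    intro i hi
    apply le_mul_of_one_le_left (hpα i hi)
    have : (2 : ℝ) ^ (x - 1) = 2 ^ x / 2 := by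
      rw [Real.rpow_sub (by norm_num), Real.rpow_one]
    linarith
end
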